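/- arXiv:1805.01223 — 2 statements merged into one kernel-verified Lean document; each statement's English description precedes it below -/
import Mathlib

section
/- Let I be a finite set, let i ∈ I, and let C : I × I → ℝ satisfy C(k,k) = 0 for all k ∈ I and the triangular condition C(a,c) < C(a,b) + C(b,c) for all a, c ∈ I and all b ∈ I with b ≠ a and b ≠ c. Let r ≥ 0, let 0 ≤ τ_1 ≤ τ_2 ≤ … be a nondecreasing sequence of nonnegative real numbers, and let (ξ_m)_{m≥0} be a sequence in I with ξ_0 = i and ξ_m ≠ ξ_{m−1} for all m ≥ 1. Then for every N ≥ 1, −∑_{m=1}^{N} e^{−r τ_m} C(ξ_{m−1}, ξ_m) ≤ max_{k ∈ I} (−C(i,k)). -/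
open scoped BigOperators

/-- Summation by parts for a cost satisfying the weak triangle inequality: discounting the costs of
a path by nonincreasing weights at most one cannot gain more than the best single discounted step. -/
theorem neg_sum_weighted_cost_le {I : Type*} {C : I → I → ℝ} {M : ℝ} {w : ℕ → ℝ} {ξ : ℕ → I}
    (htri : ∀ a b c : I, C a c ≤ C a b + C b c) (hM0 : 0 ≤ M) (hM : ∀ k, -C (ξ 0) k ≤ M)
    (hw0 : ∀ n, 0 ≤ w n) (hw1 : w 1 ≤ 1) (hw : ∀ n, 1 ≤ n → w (n + 1) ≤ w n)
    {N : ℕ} (hN : 1 ≤ N) :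
    -(∑ n ∈ Finset.Icc 1 N, w n * C (ξ (n - 1)) (ξ n))
      ≤ (1 - w N) * M - w N * C (ξ 0) (ξ N) := by
  induction N, hN using Nat.le_induction with
  | base =>
    have := mul_nonneg (sub_nonneg.2 hw1) hM0
    simpa using this
  | succ n hn ih =>
    rw [Finset.sum_Icc_succ_top (by omega), Nat.add_sub_cancel]
    have h1 := mul_le_mul_of_nonneg_left (hM (ξ n)) (sub_nonneg.2 (hw n hn))
    have h2 := mul_le_mul_of_nonneg_left (htri (ξ 0) (ξ n) (ξ (n + 1))) (hw0 (n + 1))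
    linarith

/-- **Bound on the accumulated discounted switching costs of the maximizing player.**
If the switching costs `C` vanish on the diagonal and satisfy the triangular condition,
the action times are nondecreasing and nonnegative, the regimes really switch at each
action time and start from `i`, then the accumulated discounted switching cost is
bounded above by `max_{k ∈ I} (-C i k)`. -/
theorem stmt0 {I : Type*} [Fintype I] [Nonempty I] (i : I) (C : I → I → ℝ)
    (hdiag : ∀ k : I, C k k = 0)
    (htri : ∀ a c b : I, b ≠ a → b ≠ c → C a c < C a b + C b c)
    (r : ℝ) (hr : 0 ≤ r)
    (τ : ℕ → ℝ) (hτnn : ∀ n : ℕ, 1 ≤ n → 0 ≤ τ n)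
    (hτmono : ∀ n : ℕ, 1 ≤ n → τ n ≤ τ (n + 1))
    (ξ : ℕ → I) (hξ0 : ξ 0 = i) (hξ : ∀ n : ℕ, 1 ≤ n → ξ n ≠ ξ (n - 1))
    (N : ℕ) (hN : 1 ≤ N) :
    -(∑ n ∈ Finset.Icc 1 N, Real.exp (-r * τ n) * C (ξ (n - 1)) (ξ n))
      ≤ ⨆ k : I, -C i k := by
  have htri' : ∀ a b c : I, C a c ≤ C a b + C b c := by
    intro a b c
    by_cases hba : b = a
    · simp [hba, hdiag]
    by_cases hbc : b = c
    · simp [hbc, hdiag]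
    exact (htri a c b hba hbc).le
  have hM : ∀ k, -C i k ≤ ⨆ k : I, -C i k :=
    le_ciSup (Set.finite_range fun k => -C i k).bddAbove
  have hM0 : 0 ≤ ⨆ k : I, -C i k := by simpa [hdiag] using hM i
  subst hξ0
  have hsum := neg_sum_weighted_cost_le (w := fun n => Real.exp (-r * τ n)) htri' hM0 hM
    (fun n => (Real.exp_pos _).le)
    (Real.exp_le_one_iff.2 (by nlinarith [mul_nonneg hr (hτnn 1 le_rfl)]))
    (fun n hn => Real.exp_le_exp.2 (by nlinarith [mul_le_mul_of_nonneg_left (hτmono n hn) hr])) hN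
  have hlast := mul_le_mul_of_nonneg_left (hM (ξ N)) (Real.exp_pos (-r * τ N)).le
  linarith
end

section
/- Let I be a finite set, let j ∈ I, and let χ : I × I → ℝ satisfy χ(k,k) = 0 for all k ∈ I and the triangular condition χ(a,c) < χ(a,b) + χ(b,c) for all a, c ∈ I and all b ∈ I with b ≠ a and b ≠ c. Let r ≥ 0, let 0 ≤ ρ_1 ≤ ρ_2 ≤ … be a nondecreasing sequence of nonnegative real numbers, and let (η_n)_{n≥0} be a sequence in I with η_0 = j and η_n ≠ η_{n−1} for all n ≥ 1. Then for every N ≥ 1, ∑_{n=1}^{N} e^{−r ρ_n} χ(η_{n−1}, η_n) ≥ min_{l ∈ I} χ(j,l). -/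
open scoped BigOperators

/-- Abel summation bound: a discounted sum of costs satisfying the triangle inequality along a
path dominates a convex combination of a lower bound of `χ j` and the direct cost to the
endpoint. -/
theorem le_sum_discounted_of_triangle {I : Type*} {j : I} {χ : I → I → ℝ} {m : ℝ}
    (hdiag : χ j j = 0) (htri : ∀ a b c : I, χ a c ≤ χ a b + χ b c) (hm : ∀ l, m ≤ χ j l)
    {d : ℕ → ℝ} (hd0 : ∀ n, 1 ≤ n → 0 ≤ d n) (hd1 : d 1 ≤ 1)
    (hd : ∀ n, 1 ≤ n → d (n + 1) ≤ d n) {η : ℕ → I} (hη0 : η 0 = j) {N : ℕ} (hN : 1 ≤ N) :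
    m * (1 - d N) + d N * χ j (η N) ≤ ∑ n ∈ Finset.Icc 1 N, d n * χ (η (n - 1)) (η n) := by
  induction N, hN using Nat.le_induction with
  | base =>
    have hm0 : m ≤ 0 := hdiag ▸ hm j
    simp only [Finset.Icc_self, Finset.sum_singleton, Nat.sub_self, hη0]
    nlinarith
  | succ n hn ih =>
    rw [Finset.sum_Icc_succ_top (by omega), Nat.add_sub_cancel]
    have h₁ := mul_le_mul_of_nonneg_left (htri j (η n) (η (n + 1))) (hd0 (n + 1) (by omega))
    have h₂ := mul_le_mul_of_nonneg_left (hm (η n)) (sub_nonneg.2 (hd n hn))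
    linarith

/-- **Bound on the accumulated discounted switching costs of the minimizing player.**
If the switching costs `χ` vanish on the diagonal and satisfy the triangular condition,
the action times are nondecreasing and nonnegative, the regimes really switch at each
action time and start from `j`, then the accumulated discounted switching cost is
bounded below by `min_{l ∈ I} (χ j l)`. -/
theorem stmt1 {I : Type*} [Fintype I] [Nonempty I] (j : I) (χ : I → I → ℝ)
    (hdiag : ∀ k : I, χ k k = 0)
    (htri : ∀ a c b : I, b ≠ a → b ≠ c → χ a c < χ a b + χ b c)
    (r : ℝ) (hr : 0 ≤ r)
    (ρ : ℕ → ℝ) (hρnn : ∀ n : ℕ, 1 ≤ n → 0 ≤ ρ n)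
    (hρmono : ∀ n : ℕ, 1 ≤ n → ρ n ≤ ρ (n + 1))
    (η : ℕ → I) (hη0 : η 0 = j) (hη : ∀ n : ℕ, 1 ≤ n → η n ≠ η (n - 1))
    (N : ℕ) (hN : 1 ≤ N) :
    (⨅ l : I, χ j l)
      ≤ ∑ n ∈ Finset.Icc 1 N, Real.exp (-r * ρ n) * χ (η (n - 1)) (η n) := by
  have hm : ∀ l, (⨅ l : I, χ j l) ≤ χ j l := ciInf_le (Set.finite_range _).bddBelow
  have htri' : ∀ a b c : I, χ a c ≤ χ a b + χ b c := by
    intro a b c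
    by_cases hab : b = a
    · simp [hab, hdiag]
    by_cases hbc : b = c
    · simp [hbc, hdiag]
    exact (htri a c b hab hbc).le
  have key := le_sum_discounted_of_triangle (d := fun n => Real.exp (-r * ρ n)) (hdiag j) htri' hm
    (fun _ _ => (Real.exp_pos _).le)
    (Real.exp_le_one_iff.2 (by nlinarith [mul_nonneg hr (hρnn 1 le_rfl)]))
    (fun n hn => Real.exp_le_exp.2 (by nlinarith [mul_le_mul_of_nonneg_left (hρmono n hn) hr]))
    hη0 hN
  have hlast := mul_le_mul_of_nonneg_left (hm (η N)) (Real.exp_pos (-r * ρ N)).le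
  linarith
end
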